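/- arXiv:0710.0658 — 2 statements merged into one kernel-verified Lean document; each statement's English description precedes it below -/
import Mathlib

section
/- Under the conditions of the balls-in-urns setup, the probability P(Hx ≡ 0 mod q) admits, for every λ = (λ_1,…,λ_{q−1}) ∈ (0,∞)^{q−1}, the representation P(Hx ≡ 0 mod q) = ∏_{z=1}^{q−1} [(kn_z)!·e^{mλ_z}/(mλ_z)^{kn_z}] · Q(λ)^m · P_λ(Σ_{i=1}^m W_i = k·n⃗), where Q(λ) is the probability that Σ_z z·U_z ≡ 0 mod q for independent Poissons U_z with means λ_z, and W_1,…,W_m are iid copies of (U_1,…,U_{q−1}) conditioned on Σ_z z·U_z ≡ 0 mod q. -/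
open Real

/-- Poisson pmf with mean `r` at `j`. -/
noncomputable def pois (r : ℝ) (j : ℕ) : ℝ := Real.exp (-r) * r ^ j / (j.factorial : ℝ)

/-- `Q(λ)`: the probability that `Σ_z z·U_z ≡ 0 mod q` for independent Poisson variables
`U_z` with means `λ_z`, `z = 1,…,q−1`. -/
noncomputable def Qprob (q : ℕ) (lam : Fin (q - 1) → ℝ) : ℝ :=
  ∑' u : Fin (q - 1) → ℕ,
    (∏ z : Fin (q - 1), pois (lam z) (u z)) *
      (if (∑ z : Fin (q - 1), ((z : ℕ) + 1) * u z) % q = 0 then 1 else 0)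

open Finset in
/-- Summing a statistic of the type-wise occupancy numbers over all placements of balls into urns:
the ball `a` has type `f a`, balls of type `none` are not counted, and the occupancy numbers of the
balls of type `some z` are multinomially distributed. -/
theorem sum_occupancy_eq {α β ζ : Type*} [Fintype α] [DecidableEq α] [Fintype β] [DecidableEq β]
    [Fintype ζ] [DecidableEq ζ] (f : α → Option ζ) (F : (β × ζ →₀ ℕ) → ℝ) :
    ∑ c : α → β, F (∑ a, (f a).elim 0 fun z => Finsupp.single (c a, z) 1) =
      (Fintype.card β : ℝ) ^ #{a | f a = none} *
        ∑ W ∈ Fintype.piFinset fun z => piAntidiag (univ : Finset β) #{a | f a = some z},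
          (∏ z, (Nat.multinomial univ (W z) : ℝ)) *
            F (Finsupp.equivFunOnFinite.symm fun p => W p.2 p.1) := by
  let h : Option ζ → β → (β × ζ →₀ ℕ) := fun o j => o.elim 0 fun z => Finsupp.single (j, z) 1
  let M : (β × ζ →₀ ℕ) → MvPolynomial (β × ζ) ℝ := fun s => MvPolynomial.monomial s 1
  let L := (MvPolynomial.basisMonomials (β × ζ) ℝ).constr ℝ F
  have hL : ∀ s, L (M s) = F s := fun s => by
    simpa [M] using (MvPolynomial.basisMonomials (β × ζ) ℝ).constr_basis ℝ F s
  have key : ∑ c : α → β, M (∑ a, h (f a) (c a)) =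
      (Fintype.card β : ℝ) ^ #{a | f a = none} •
        ∑ W ∈ Fintype.piFinset fun z => piAntidiag (univ : Finset β) #{a | f a = some z},
          (∏ z, (Nat.multinomial univ (W z) : ℝ)) •
            M (Finsupp.equivFunOnFinite.symm fun p => W p.2 p.1) := by
    calc ∑ c : α → β, M (∑ a, h (f a) (c a))
        = ∑ c : α → β, ∏ a, M (h (f a) (c a)) := by simp only [M, MvPolynomial.monomial_sum_one]
      _ = ∏ a, ∑ j, M (h (f a) j) := by
          rw [prod_univ_sum, Fintype.piFinset_univ]
      _ = ∏ o, (∑ j, M (h o j)) ^ #{a | f a = o} := by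
          rw [← prod_fiberwise_of_maps_to (g := f) (t := univ) (fun _ _ => mem_univ _)]
          refine prod_congr rfl fun o _ => ?_
          rw [prod_congr rfl (g := fun _ => ∑ j, M (h o j)), prod_const]
          intro a ha
          rw [(mem_filter.mp ha).2]
      _ = _ := by
          rw [Fintype.prod_option]
          have h0 : ∑ j, M (h none j) = MvPolynomial.C (Fintype.card β : ℝ) := by
            simp [M, h]
          have h1 : ∀ z, (∑ j, M (h (some z) j)) ^ #{a | f a = some z} =
              ∑ w ∈ piAntidiag (univ : Finset β) #{a | f a = some z},
                (Nat.multinomial univ w : MvPolynomial (β × ζ) ℝ) *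
                  ∏ j, M (h (some z) j) ^ w j := fun z => sum_pow_eq_sum_piAntidiag _ _ _
          simp only [h0, h1]
          rw [prod_univ_sum, ← map_pow, ← MvPolynomial.smul_eq_C_mul]
          congr 1
          refine sum_congr rfl fun W _ => ?_
          rw [prod_mul_distrib, MvPolynomial.smul_eq_C_mul]
          congr 1
          · simp
          · have : Finsupp.equivFunOnFinite.symm (fun p : β × ζ => W p.2 p.1) =
                ∑ z, ∑ j, W z j • Finsupp.single (j, z) 1 := by
              ext ⟨j, z⟩
              simp [Finsupp.finsetSum_apply, Finsupp.single_apply, Prod.ext_iff, ite_and]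
            simp only [this, M, MvPolynomial.monomial_sum_one]
            refine prod_congr rfl fun z _ => prod_congr rfl fun j _ => ?_
            simp [h, MvPolynomial.monomial_pow]
  simpa [hL, h] using congrArg L key

theorem pois_nonneg {r : ℝ} (hr : 0 ≤ r) (j : ℕ) : 0 ≤ pois r j := by
  unfold pois; positivity

theorem pois_pos {r : ℝ} (hr : 0 < r) (j : ℕ) : 0 < pois r j := by
  unfold pois; positivity

theorem sum_pois_le_one {r : ℝ} (hr : 0 ≤ r) (s : Finset ℕ) : ∑ j ∈ s, pois r j ≤ 1 := by
  have h : HasSum (fun j => pois r j) 1 := by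
    have := (NormedSpace.expSeries_div_hasSum_exp r).mul_left (Real.exp (-r))
    rw [← Real.exp_eq_exp_ℝ, ← Real.exp_add, neg_add_cancel, Real.exp_zero] at this
    simpa only [pois, mul_div_assoc] using this
  exact sum_le_hasSum s (fun j _ => pois_nonneg hr j) h

theorem summable_prod_pois {ζ : Type*} [Fintype ζ] {lam : ζ → ℝ} (hlam : ∀ z, 0 ≤ lam z) :
    Summable fun u : ζ → ℕ => ∏ z, pois (lam z) (u z) := by
  classical
  refine summable_of_sum_le (c := 1)
    (fun u => Finset.prod_nonneg fun z _ => pois_nonneg (hlam z) _) fun s => ?_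
  calc ∑ u ∈ s, ∏ z, pois (lam z) (u z)
      ≤ ∑ u ∈ Fintype.piFinset fun z => s.image fun u => u z, ∏ z, pois (lam z) (u z) := by
        refine Finset.sum_le_sum_of_subset_of_nonneg (fun u hu => ?_)
          fun u _ _ => Finset.prod_nonneg fun z _ => pois_nonneg (hlam z) _
        exact Fintype.mem_piFinset.mpr fun z => Finset.mem_image_of_mem (fun u : ζ → ℕ => u z) hu
    _ = ∏ z, ∑ j ∈ s.image fun u => u z, pois (lam z) j := (Finset.prod_univ_sum _ _).symm
    _ ≤ 1 := Finset.prod_le_one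
        (fun z _ => Finset.sum_nonneg fun j _ => pois_nonneg (hlam z) j)
        fun z _ => sum_pois_le_one (hlam z) _

theorem Qprob_pos (q : ℕ) {lam : Fin (q - 1) → ℝ} (hlam : ∀ z, 0 < lam z) :
    0 < Qprob q lam := by
  have hnn : ∀ u : Fin (q - 1) → ℕ, 0 ≤ ∏ z, pois (lam z) (u z) := fun u =>
    Finset.prod_nonneg fun z _ => pois_nonneg (hlam z).le _
  refine Summable.tsum_pos (Summable.of_nonneg_of_le (fun u => ?_) (fun u => ?_)
    (summable_prod_pois fun z => (hlam z).le)) (fun u => ?_) 0 ?_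
  · exact mul_nonneg (hnn u) (by split_ifs <;> norm_num)
  · exact mul_le_of_le_one_right (hnn u) (by split_ifs <;> norm_num)
  · exact mul_nonneg (hnn u) (by split_ifs <;> norm_num)
  · simpa using Finset.prod_pos fun z _ => pois_pos (hlam z) 0

open Finset in
/-- The joint law of `|β|` iid Poisson variables of mean `r`, in terms of the multinomial law of
their values given their sum. -/
theorem prod_pois_eq_multinomial {β : Type*} [Fintype β] [Nonempty β] {r : ℝ}
    (hr : 0 < r) (w : β → ℕ) :
    ((∑ j, w j).factorial : ℝ) * Real.exp (Fintype.card β * r) /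
        ((Fintype.card β : ℝ) * r) ^ (∑ j, w j) * ∏ j, pois r (w j) =
      (Nat.multinomial univ w : ℝ) / (Fintype.card β : ℝ) ^ (∑ j, w j) := by
  have hc : (Fintype.card β : ℝ) ≠ 0 := by exact_mod_cast Fintype.card_ne_zero
  have hw : (∏ j, ((w j).factorial : ℝ)) ≠ 0 :=
    prod_ne_zero_iff.mpr fun j _ => by exact_mod_cast (w j).factorial_ne_zero
  have hspec : (∏ j, ((w j).factorial : ℝ)) * (Nat.multinomial univ w : ℝ) =
      ((∑ j, w j).factorial : ℝ) := by exact_mod_cast Nat.multinomial_spec univ w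
  have hexp : Real.exp (Fintype.card β * r) * Real.exp (-r) ^ Fintype.card β = 1 := by
    rw [← Real.exp_nat_mul, ← Real.exp_add, mul_neg, add_neg_cancel, Real.exp_zero]
  simp only [pois]
  rw [prod_div_distrib, prod_mul_distrib, prod_pow_eq_pow_sum, prod_const, card_univ, ← hspec,
    mul_pow]
  have hr' := hr.ne'
  field_simp
  linear_combination (Nat.multinomial univ w : ℝ) * hexp

/-- Poissonization identity: with `H` the random `m×n` matrix with iid weight-`k` columns
(encoded by `c : Fin n → Fin k → Fin m`, uniform) and `x ∈ {0,…,q−1}^n` with `n_z`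
entries equal to `z`, for every `λ ∈ (0,∞)^{q−1}`,
`P(Hx ≡ 0 mod q) = ∏_z [(kn_z)!·e^{mλ_z}/(mλ_z)^{kn_z}] · Q(λ)^m · P_λ(Σ_{i=1}^m W_i = k·n⃗)`,
where `W_1,…,W_m` are iid tuples of independent Poissons of means `λ_z` conditioned on
`Σ_z z·W_z ≡ 0 mod q`. -/
theorem poissonization_identity (q n m k : ℕ) (hq : 2 ≤ q) (hm : 0 < m)
    (x : Fin n → Fin q) (nz : Fin (q - 1) → ℕ)
    (hnz : ∀ z : Fin (q - 1), Nat.card {i : Fin n // (x i : ℕ) = (z : ℕ) + 1} = nz z)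
    (lam : Fin (q - 1) → ℝ) (hlam : ∀ z, 0 < lam z) :
    (Nat.card {c : Fin n → Fin k → Fin m //
        ∀ j : Fin m, (∑ i : Fin n, ∑ t : Fin k,
          if c i t = j then (x i : ℕ) else 0) % q = 0} : ℝ) / (m : ℝ) ^ (n * k)
      = (∏ z : Fin (q - 1),
          ((k * nz z).factorial : ℝ) * Real.exp (m * lam z) /
            ((m : ℝ) * lam z) ^ (k * nz z)) *
        (Qprob q lam) ^ m *
        (∑' w : Fin m → Fin (q - 1) → ℕ,
          (∏ i : Fin m,
            (∏ z : Fin (q - 1), pois (lam z) (w i z)) *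
              (if (∑ z : Fin (q - 1), ((z : ℕ) + 1) * w i z) % q = 0 then 1 else 0) /
                Qprob q lam) *
          (if ∀ z : Fin (q - 1), (∑ i : Fin m, w i z) = k * nz z then 1 else 0)) := by
  classical
  have : Nonempty (Fin m) := ⟨⟨0, hm⟩⟩
  have hm0 : (m : ℝ) ≠ 0 := by exact_mod_cast hm.ne'
  have hQ := (Qprob_pos q hlam).ne'
  obtain ⟨f, hf⟩ : ∃ f : Fin n × Fin k → Option (Fin (q - 1)),
      ∀ p z, f p = some z ↔ (x p.1 : ℕ) = z + 1 := by
    refine ⟨fun p => if h : (x p.1 : ℕ) = 0 then none else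
      some ⟨x p.1 - 1, by have := (x p.1).isLt; omega⟩, fun p z => ?_⟩
    dsimp only
    split_ifs with h
    · simp [h]
    · simp only [Option.some.injEq, Fin.ext_iff]
      omega
  have hN : ∀ z, (Finset.univ.filter fun p => f p = some z).card = k * nz z := fun z => by
    have : (Finset.univ.filter fun p => f p = some z) =
        (Finset.univ.filter fun i => (x i : ℕ) = z + 1) ×ˢ (Finset.univ : Finset (Fin k)) := by
      ext p
      simp [hf]
    rw [this, Finset.card_product, ← hnz z, Nat.card_eq_fintype_card, Fintype.card_subtype,
      Finset.card_univ, Fintype.card_fin, mul_comm]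
  have hN0 : (Finset.univ.filter fun p => f p = none).card + ∑ z, k * nz z = n * k := by
    simp only [← hN]
    rw [← Fintype.sum_option fun o => (Finset.univ.filter fun p => f p = o).card,
      ← Finset.card_eq_sum_card_fiberwise fun _ _ => Finset.mem_univ _]
    simp
  let F : (Fin m × Fin (q - 1) →₀ ℕ) → ℝ := fun s =>
    if ∀ j : Fin m, (∑ z : Fin (q - 1), ((z : ℕ) + 1) * s (j, z)) % q = 0 then 1 else 0
  have hball : ∀ (p : Fin n × Fin k) (j j' : Fin m),
      ∑ z : Fin (q - 1), ((z : ℕ) + 1) *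
        ((f p).elim 0 fun z => Finsupp.single (j', z) 1 : Fin m × Fin (q - 1) →₀ ℕ) (j, z) =
      if j' = j then (x p.1 : ℕ) else 0 := fun p j j' => by
    rcases h : f p with _ | z
    · have : (x p.1 : ℕ) = 0 := by
        by_contra h0
        have h1 := (hf p ⟨x p.1 - 1, by have := (x p.1).isLt; omega⟩).mpr
          (by simp only; omega)
        simp [h] at h1
      simp [this]
    · rw [(hf p z).mp h]
      simp [Finsupp.single_apply, Prod.ext_iff, ite_and]
  have hcard : (Nat.card {c : Fin n → Fin k → Fin m //
        ∀ j : Fin m, (∑ i : Fin n, ∑ t : Fin k,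
          if c i t = j then (x i : ℕ) else 0) % q = 0} : ℝ) =
      ∑ c : Fin n × Fin k → Fin m,
        F (∑ p, (f p).elim 0 fun z => Finsupp.single (c p, z) 1) := by
    rw [Nat.card_eq_fintype_card, Fintype.card_subtype, Finset.card_filter, Nat.cast_sum]
    refine Fintype.sum_equiv (Equiv.curry _ _ _).symm _ _ fun c => ?_
    have : ∀ j, ∑ z : Fin (q - 1), ((z : ℕ) + 1) *
        (∑ p, (f p).elim 0 fun z => Finsupp.single ((Equiv.curry _ _ _).symm c p, z) 1 :
          Fin m × Fin (q - 1) →₀ ℕ) (j, z) =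
        ∑ i : Fin n, ∑ t : Fin k, if c i t = j then (x i : ℕ) else 0 := fun j => by
      simp only [Finsupp.finsetSum_apply, Finset.mul_sum]
      rw [Finset.sum_comm]
      simp only [hball, Fintype.sum_prod_type]
      rfl
    simp only [F, this, Nat.cast_ite, Nat.cast_one, Nat.cast_zero]
  rw [hcard, sum_occupancy_eq, ← (Equiv.piComm fun _ _ => ℕ).tsum_eq,
    tsum_eq_sum (s := Fintype.piFinset fun z =>
      Finset.piAntidiag (Finset.univ : Finset (Fin m)) (k * nz z))]
  · simp only [hN, Fintype.card_fin, Finset.mul_sum, Finset.sum_div]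
    refine Finset.sum_congr rfl fun W hW => ?_
    have hW' : ∀ z, ∑ j, W z j = k * nz z := fun z =>
      (Finset.mem_piAntidiag.mp (Fintype.mem_piFinset.mp hW z)).1
    have hind : F (Finsupp.equivFunOnFinite.symm fun p => W p.2 p.1) =
        ∏ j : Fin m, if (∑ z : Fin (q - 1), ((z : ℕ) + 1) * W z j) % q = 0
          then (1 : ℝ) else 0 := by
      simp [F, Finset.prod_ite_zero]
    have hpois : (∏ z : Fin (q - 1), ((k * nz z).factorial : ℝ) * Real.exp (m * lam z) /
          ((m : ℝ) * lam z) ^ (k * nz z)) * ∏ j, ∏ z, pois (lam z) (W z j) =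
        (∏ z, (Nat.multinomial Finset.univ (W z) : ℝ)) / (m : ℝ) ^ ∑ z, k * nz z := by
      rw [Finset.prod_comm, ← Finset.prod_mul_distrib, ← Finset.prod_pow_eq_pow_sum,
        ← Finset.prod_div_distrib]
      refine Finset.prod_congr rfl fun z _ => ?_
      simpa [hW'] using prod_pois_eq_multinomial (hlam z) (W z)
    have hjoint : ∏ j : Fin m, (∏ z, pois (lam z) (W z j)) *
          (if (∑ z : Fin (q - 1), ((z : ℕ) + 1) * W z j) % q = 0 then 1 else 0) / Qprob q lam =
        (∏ j, ∏ z, pois (lam z) (W z j)) *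
          F (Finsupp.equivFunOnFinite.symm fun p => W p.2 p.1) / Qprob q lam ^ m := by
      rw [hind, Finset.prod_div_distrib, Finset.prod_mul_distrib, Finset.prod_const,
        Finset.card_univ, Fintype.card_fin]
    simp only [Equiv.piComm_apply, Function.swap, hW', implies_true, if_true, mul_one]
    rw [hjoint, ← hN0, pow_add]
    have hp := pow_ne_zero m hQ
    generalize F _ = I
    trans (∏ z, (Nat.multinomial Finset.univ (W z) : ℝ)) / (m : ℝ) ^ (∑ z, k * nz z) * I
    · field_simp
    · rw [← hpois]
      field_simp
  · intro W hW
    refine mul_eq_zero_of_right _ (if_neg fun h => hW ?_)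
    exact Fintype.mem_piFinset.mpr fun z => Finset.mem_piAntidiag.mpr
      ⟨h z, fun j _ => Finset.mem_univ j⟩
end

section
/- Let H be the random m×n matrix with iid weight-k columns over Z_q (q prime, q ∤ k, 3 ≤ k ≤ m/log m, m ≤ n, (m/nk)^{1/k} ≥ Δ > 0). Then there exist constants B, C depending only on q and Δ such that, whenever E ≤ C·m/log(nk/m), the probability that there exists a nonzero z ∈ {0,…,q−1}^n with at most E nonzero entries and Hz ≡ 0 mod q is at most n^2·(Bk/m)^{k/q}. -/
open Real

theorem card_support_sum_single_le {G : Type*} [AddCommGroup G] [DecidableEq G] {m L : ℕ}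
    (a : Fin L → G) (f : Fin L → Fin m) :
    (Finset.univ.filter fun j => (∑ i, Pi.single (f i) (a i) : Fin m → G) j ≠ 0).card ≤ L := by
  calc _ ≤ (Finset.univ.image f).card := by
        apply Finset.card_le_card
        intro j hj
        by_contra h
        simp only [Finset.mem_image, Finset.mem_univ, true_and, not_exists] at h
        simp only [Finset.mem_filter, Finset.mem_univ, true_and, Finset.sum_apply] at hj
        exact hj (Finset.sum_eq_zero fun i _ => Pi.single_eq_of_ne (fun e => h i e.symm) _)
    _ ≤ L := Finset.card_image_le.trans (by simp)

theorem sum_indicator_sum_single_eq_le {G : Type*} [AddCommGroup G] [DecidableEq G] {m : ℕ}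
    {u : ℝ} (hu₀ : 0 ≤ u) (hu₁ : u ≤ 1) (L : ℕ) (a : Fin L → G) (ha : ∀ i, a i ≠ 0)
    (hL : (L : ℝ) ≤ u ^ 2 * m) (r : Fin m → G) :
    (∑ f : Fin L → Fin m, if ∑ i, Pi.single (f i) (a i) = r then (1 : ℝ) else 0) ≤
      (2 * m) ^ L * u ^ (L + (Finset.univ.filter fun j => r j ≠ 0).card) := by
  induction L generalizing r with
  | zero =>
    by_cases hr : r = 0
    · subst hr; simp
    · have : (0 : Fin m → G) ≠ r := fun h => hr h.symm
      simp [this]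
      positivity
  | succ L ih =>
    set s := (Finset.univ.filter fun j => r j ≠ 0).card with hs
    by_cases hsL : L + 1 < s
    · rw [Finset.sum_eq_zero]
      · positivity
      · intro f _
        rw [if_neg]
        rintro rfl
        exact absurd (card_support_sum_single_le a f) (by omega)
    rw [← (Fin.consEquiv fun _ => Fin m).sum_comp, Fintype.sum_prod_type]
    have hL' : (L : ℝ) ≤ u ^ 2 * m := le_trans (by simp) hL
    have key : ∀ j : Fin m, (∑ g : Fin L → Fin m,
        if ∑ i, Pi.single ((Fin.consEquiv fun _ => Fin m) (j, g) i) (a i) = r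
          then (1 : ℝ) else 0) ≤
        (2 * m) ^ L * (u ^ (L + s + 1) + if r j ≠ 0 then u ^ (L + s - 1) else 0) := by
      intro j
      have h1 := ih (fun i => a i.succ) (fun i => ha _) hL' (r - Pi.single j (a 0))
      have h2 : ∀ g : Fin L → Fin m,
          (∑ i, Pi.single ((Fin.consEquiv fun _ => Fin m) (j, g) i) (a i) = r) ↔
          (∑ i, Pi.single (g i) (a i.succ) = r - Pi.single j (a 0)) := by
        intro g
        rw [Fin.sum_univ_succ, eq_sub_iff_add_eq']
        simp [Fin.consEquiv]
      simp only [h2]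
      refine h1.trans ?_
      gcongr
      by_cases hj : r j = 0
      · have : (Finset.univ.filter fun i => (r - Pi.single j (a 0) : Fin m → G) i ≠ 0) =
            insert j (Finset.univ.filter fun i => r i ≠ 0) := by
          ext i
          by_cases hij : i = j
          · subst hij; simp [hj, ha 0]
          · simp [hij]
        rw [this, Finset.card_insert_of_notMem (by simp [hj]), ← hs]
        simp [hj, add_assoc]
      · have : (Finset.univ.filter fun i => r i ≠ 0).erase j ⊆
            (Finset.univ.filter fun i => (r - Pi.single j (a 0) : Fin m → G) i ≠ 0) := by
          intro i
          simp only [Finset.mem_erase, Finset.mem_filter, Finset.mem_univ, true_and]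
          rintro ⟨h, h'⟩
          simpa [h] using h'
        have h3 := Finset.card_le_card this
        rw [Finset.card_erase_of_mem (by simp [hj]), ← hs] at h3
        have h4 : 0 < s := Finset.card_pos.2 ⟨j, by simp [hj]⟩
        rw [if_pos hj]
        have : u ^ (L + (Finset.univ.filter fun i => (r - Pi.single j (a 0) : Fin m → G) i ≠ 0).card)
            ≤ u ^ (L + s - 1) := pow_le_pow_of_le_one hu₀ hu₁ (by omega)
        have : 0 ≤ u ^ (L + s + 1) := by positivity
        linarith
    refine (Finset.sum_le_sum fun j _ => key j).trans ?_
    rw [← Finset.mul_sum, Finset.sum_add_distrib, ← Finset.sum_filter]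
    simp only [Finset.sum_const, Finset.card_univ, Fintype.card_fin, nsmul_eq_mul, ← hs]
    have h5 : (s : ℝ) * u ^ (L + s - 1) ≤ m * u ^ (L + s + 1) := by
      rcases Nat.eq_zero_or_pos s with h0 | h0
      · rw [h0]; simp; positivity
      · have : (s : ℝ) ≤ u ^ 2 * m := le_trans (by exact_mod_cast (not_lt.1 hsL)) hL
        calc (s : ℝ) * u ^ (L + s - 1) ≤ u ^ 2 * m * u ^ (L + s - 1) := by gcongr
          _ = m * u ^ (L + s - 1 + 2) := by ring
          _ = _ := by congr 2; omega
    calc _ ≤ (2 * (m : ℝ)) ^ L * (m * u ^ (L + s + 1) + m * u ^ (L + s + 1)) := by gcongr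
      _ = _ := by rw [show L + 1 + s = L + s + 1 by ring]; ring

theorem card_sum_single_eq_zero_le {ι G : Type*} [Fintype ι] [DecidableEq ι] [AddCommGroup G]
    [DecidableEq G] {m : ℕ} {u : ℝ} (hu₀ : 0 ≤ u) (hu₁ : u ≤ 1) (T : Finset ι) (a : ι → G)
    (ha : ∀ i ∈ T, a i ≠ 0) (hT : (T.card : ℝ) ≤ u ^ 2 * m) :
    ((Finset.univ.filter fun f : ι → Fin m => ∑ i, Pi.single (f i) (a i) = (0 : Fin m → G)).card
      : ℝ) ≤ m ^ Fintype.card ι * (2 * u) ^ T.card := by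
  rw [Finset.card_filter]
  push_cast
  rw [← (Equiv.piEquivPiSubtypeProd (· ∈ T) fun _ => Fin m).symm.sum_comp,
    Fintype.sum_prod_type_right]
  have key : ∀ g : {i // i ∉ T} → Fin m, (∑ f : {i // i ∈ T} → Fin m,
      if ∑ i, Pi.single ((Equiv.piEquivPiSubtypeProd (· ∈ T) fun _ => Fin m).symm (f, g) i) (a i)
        = (0 : Fin m → G) then (1 : ℝ) else 0) ≤ (2 * m) ^ T.card * u ^ T.card := by
    intro g
    set r : Fin m → G := - ∑ i, Pi.single (g i) (a i) with hr
    have e : {i // i ∈ T} ≃ Fin T.card := T.equivFin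
    have h1 := sum_indicator_sum_single_eq_le hu₀ hu₁ T.card (fun i => a (e.symm i))
      (fun i => ha _ (e.symm i).2) hT r
    have h2 : ∀ f : {i // i ∈ T} → Fin m, (∑ i, Pi.single
        ((Equiv.piEquivPiSubtypeProd (· ∈ T) fun _ => Fin m).symm (f, g) i) (a i)
          = (0 : Fin m → G)) ↔ ∑ i, Pi.single (f (e.symm i)) (a (e.symm i)) = r := by
      intro f
      rw [← Fintype.sum_subtype_add_sum_subtype (· ∈ T), hr, ← add_eq_zero_iff_eq_neg,
        e.symm.sum_comp fun i => (Pi.single (f i) (a i) : Fin m → G)]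
      have h3 : ∀ i : {i // i ∈ T}, (Equiv.piEquivPiSubtypeProd (· ∈ T) fun _ => Fin m).symm
          (f, g) i = f i := fun i => by simp [Equiv.piEquivPiSubtypeProd]
      have h4 : ∀ i : {i // i ∉ T}, (Equiv.piEquivPiSubtypeProd (· ∈ T) fun _ => Fin m).symm
          (f, g) i = g i := fun i => by simp [Equiv.piEquivPiSubtypeProd, i.2]
      simp only [h3, h4]
      convert Iff.rfl
    simp only [h2]
    rw [← (e.arrowCongr (Equiv.refl (Fin m))).symm.sum_comp]
    simp only [Equiv.arrowCongr_symm, Equiv.arrowCongr_apply, Equiv.refl_symm, Equiv.coe_refl,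
      Equiv.symm_symm, Function.comp_apply, Equiv.apply_symm_apply, id_eq]
    refine h1.trans ?_
    gcongr ?_ * ?_
    exact pow_le_pow_of_le_one hu₀ hu₁ (by omega)
  refine (Finset.sum_le_sum fun g _ => key g).trans ?_
  have hc : Fintype.card ι = Fintype.card {i // i ∉ T} + T.card := by
    rw [Fintype.card_subtype_compl, Fintype.card_coe, Nat.sub_add_cancel T.card_le_univ]
  simp only [Finset.sum_const, Finset.card_univ, nsmul_eq_mul, Fintype.card_fun, Fintype.card_fin]
  push_cast
  rw [hc]
  apply le_of_eq
  ring

theorem card_weight_eq_le {n q w : ℕ} [NeZero q] :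
    ((Finset.univ.filter fun z : Fin n → Fin q =>
      (Finset.univ.filter fun i => z i ≠ 0).card = w).card : ℝ) ≤
      (exp 1 * n * q / w) ^ w := by
  have h1 : (Finset.univ.filter fun z : Fin n → Fin q =>
      (Finset.univ.filter fun i => z i ≠ 0).card = w) ⊆
      ((Finset.univ : Finset (Fin n)).powersetCard w).biUnion fun S =>
        Fintype.piFinset fun i => if i ∈ S then Finset.univ else {0} := by
    intro z hz
    simp only [Finset.mem_filter, Finset.mem_univ, true_and] at hz
    simp only [Finset.mem_biUnion, Finset.mem_powersetCard, Finset.subset_univ, true_and,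
      Fintype.mem_piFinset]
    refine ⟨_, hz, fun i => ?_⟩
    by_cases h : z i = 0 <;> simp [h]
  have h2 : (Finset.univ.filter fun z : Fin n → Fin q =>
      (Finset.univ.filter fun i => z i ≠ 0).card = w).card ≤ n.choose w * q ^ w := by
    refine (Finset.card_le_card h1).trans (Finset.card_biUnion_le.trans ?_)
    rw [Finset.sum_congr rfl (g := fun _ => q ^ w)]
    · simp
    · intro S hS
      rw [Finset.mem_powersetCard] at hS
      rw [Fintype.card_piFinset, ← hS.2]
      simp [apply_ite Finset.card]
  have h3 : (n.choose w : ℝ) ≤ n ^ w / w.factorial := Nat.choose_le_pow_div w n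
  have h4 : (w : ℝ) ^ w / w.factorial ≤ exp w := pow_div_factorial_le_exp _ (by positivity) _
  have h5 : (n : ℝ) ^ w / w.factorial ≤ (exp 1 * n / w) ^ w := by
    rcases Nat.eq_zero_or_pos w with rfl | hw
    · simp
    rw [div_le_iff₀ (by positivity)] at h4
    rw [div_pow, mul_pow, ← exp_nat_mul, mul_one, div_le_div_iff₀ (by positivity) (by positivity)]
    nlinarith [show (0 : ℝ) ≤ n ^ w by positivity]
  calc _ ≤ (n.choose w : ℝ) * q ^ w := by exact_mod_cast h2
    _ ≤ (exp 1 * n / w) ^ w * q ^ w := by gcongr; exact h3.trans h5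
    _ = _ := by rw [← mul_pow]; congr 1; ring

theorem sparse_term_le {n q k w : ℕ} {y Δ A B : ℝ} (hΔ : 0 < Δ) (hq : 2 ≤ q) (hk : 3 ≤ k)
    (hw : 1 ≤ w) (hy : 0 < y) (hny₁ : 1 ≤ n * y) (hny : n * y ≤ (1 / Δ) ^ k)
    (hA : A = 6 * q * (1 + 1 / Δ)) (hwy : A ^ 6 * (w * y) ≤ 1 / 2) (hB : A ^ 6 ≤ B) :
    (exp 1 * n * q / w) ^ w * (2 * √(w * y)) ^ (w * k) ≤ n * √(B * y) ^ k := by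
  have hq' : (2 : ℝ) ≤ q := by exact_mod_cast hq
  have hw' : (1 : ℝ) ≤ w := by exact_mod_cast hw
  have hD : 0 < 1 / Δ := by positivity
  have hA1 : 1 ≤ A := by rw [hA]; nlinarith [mul_pos (by linarith : (0 : ℝ) < q) hD]
  set v := √(w * y) with hv
  have hv0 : 0 < v := by positivity
  have hv2 : v ^ 2 = w * y := sq_sqrt (by positivity)
  obtain ⟨l, rfl⟩ : ∃ l, k = l + 3 := ⟨k - 3, by omega⟩
  have h1 : exp 1 * n * q / w * (2 * v) ^ (l + 3) ≤ (A ^ 3 * v) ^ (l + 1) := by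
    have e1 : exp 1 * n * q / w * (2 * v) ^ (l + 3) =
        exp 1 * q * 2 ^ (l + 3) * (n * y) * v ^ (l + 1) := by
      rw [show (2 * v) ^ (l + 3) = 2 ^ (l + 3) * v ^ (l + 1) * v ^ 2 by ring, hv2]
      field_simp
    rw [e1, mul_pow]
    gcongr
    calc exp 1 * q * 2 ^ (l + 3) * (n * y)
        ≤ 3 * q * 2 ^ (l + 3) * (1 / Δ) ^ (l + 3) := by
          gcongr
          exact exp_one_lt_three.le
      _ ≤ (3 * q) ^ (l + 3) * 2 ^ (l + 3) * (1 / Δ) ^ (l + 3) := by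
          gcongr
          exact le_self_pow₀ (by linarith) (by omega)
      _ = (6 * q * (1 / Δ)) ^ (l + 3) := by rw [← mul_pow, ← mul_pow]; ring
      _ ≤ A ^ (l + 3) := by
          rw [hA]; gcongr; linarith
      _ ≤ A ^ (3 * (l + 1)) := pow_le_pow_right₀ hA1 (by omega)
      _ = (A ^ 3) ^ (l + 1) := by rw [pow_mul]
  have h2 : (A ^ 3 * v) ^ w ≤ A ^ 3 * √y := by
    have e2 : ((A ^ 3 * v) ^ w) ^ 2 ≤ (A ^ 3 * √y) ^ 2 := by
      have : ((A ^ 3 * v) ^ w) ^ 2 = (A ^ 6 * (w * y)) ^ w := by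
        rw [← pow_mul, mul_comm w 2, pow_mul, mul_pow, hv2]; ring
      rw [this, mul_pow (A ^ 3) √y, sq_sqrt hy.le]
      obtain ⟨t, rfl⟩ : ∃ t, w = t + 1 := ⟨w - 1, by omega⟩
      have e3 : ((t + 1 : ℕ) : ℝ) ≤ 2 ^ t := by exact_mod_cast Nat.lt_two_pow_self (n := t)
      calc (A ^ 6 * ((t + 1 : ℕ) * y)) ^ (t + 1)
          = (A ^ 6 * ((t + 1 : ℕ) * y)) ^ t * (A ^ 6 * ((t + 1 : ℕ) * y)) := pow_succ _ _
        _ ≤ (1 / 2) ^ t * (A ^ 6 * (2 ^ t * y)) := by gcongr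
        _ = (1 / 2 * 2) ^ t * (A ^ 6 * y) := by rw [mul_pow]; ring
        _ = (A ^ 3) ^ 2 * y := by
          rw [one_div_mul_cancel two_ne_zero, one_pow]; ring
    exact (pow_le_pow_iff_left₀ (by positivity) (by positivity) two_ne_zero).1 e2
  have h3 : A ^ 3 * √y ≤ √(B * y) := by
    apply le_sqrt_of_sq_le
    rw [mul_pow, sq_sqrt hy.le]
    calc (A ^ 3) ^ 2 * y = A ^ 6 * y := by ring
      _ ≤ _ := by gcongr
  calc _ = (exp 1 * n * q / w * (2 * v) ^ (l + 3)) ^ w := by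
        rw [mul_pow _ _ w, ← pow_mul, mul_comm w]
    _ ≤ ((A ^ 3 * v) ^ (l + 1)) ^ w := by gcongr
    _ = ((A ^ 3 * v) ^ w) ^ (l + 1) := pow_right_comm _ _ _
    _ ≤ (A ^ 3 * √y) ^ (l + 1) := by gcongr
    _ ≤ (A ^ 3 * √y) ^ (l + 1) * ((A ^ 3) ^ 2 * (n * y)) := by
        apply le_mul_of_one_le_right (by positivity)
        exact one_le_mul_of_one_le_of_one_le (one_le_pow₀ (one_le_pow₀ hA1)) hny₁
    _ = n * (A ^ 3 * √y) ^ (l + 3) := by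
        rw [show (A ^ 3 * √y) ^ (l + 3) = (A ^ 3 * √y) ^ (l + 1) * ((A ^ 3) ^ 2 * √y ^ 2) by ring,
          sq_sqrt hy.le]
        ring
    _ ≤ _ := by gcongr

theorem entropy_term_le {n m q k w : ℕ} {x C : ℝ} (hq : 2 ≤ q) (hk : 3 ≤ k) (hm : 1 ≤ m)
    (hw : 1 ≤ w) (hmn : m ≤ n) (hx : 0 < x) (hx1 : x ≤ 1) (hwk : x * m ≤ w * k)
    (hC : C = x / 4 / (1 + log (exp 1 * q / x)))
    (hwC : (w : ℝ) ≤ C * m / log ((n : ℝ) * k / m)) :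
    (exp 1 * n * q / w) ^ w ≤ exp (x * m / 4) := by
  have hq' : (2 : ℝ) ≤ q := by exact_mod_cast hq
  have hw' : (1 : ℝ) ≤ w := by exact_mod_cast hw
  have hm' : (1 : ℝ) ≤ m := by exact_mod_cast hm
  have hk' : (3 : ℝ) ≤ k := by exact_mod_cast hk
  have hmn' : (m : ℝ) ≤ n := by exact_mod_cast hmn
  have hn' : (0 : ℝ) < n := by linarith
  set ν := log ((n : ℝ) * k / m) with hν
  have hν1 : 1 ≤ ν := by
    rw [hν, le_log_iff_exp_le (by positivity), le_div_iff₀ (by positivity)]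
    nlinarith [exp_one_lt_three]
  have hK : 0 ≤ log (exp 1 * q / x) := by
    apply log_nonneg
    rw [le_div_iff₀ hx]
    nlinarith [add_one_le_exp (1 : ℝ)]
  set K := log (exp 1 * q / x) with hKd
  rw [le_div_iff₀ (by linarith)] at hwC
  have h1 : exp 1 * n * q / w ≤ exp (ν * (1 + K)) := by
    calc exp 1 * n * q / w ≤ exp 1 * q / x * (n * k / m) := by
          rw [div_mul_div_comm, div_le_div_iff₀ (by positivity) (by positivity)]
          have : 0 ≤ exp 1 * n * q := by positivity
          nlinarith
      _ = exp (K + ν) := by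
          rw [exp_add, exp_log (by positivity), exp_log (by positivity)]
      _ ≤ _ := by apply exp_le_exp.2; nlinarith
  calc _ ≤ exp (ν * (1 + K)) ^ w := by gcongr
    _ = exp (w * ν * (1 + K)) := by rw [← exp_nat_mul, mul_assoc]
    _ ≤ exp (C * m * (1 + K)) := by gcongr
    _ = _ := by rw [hC]; congr 1; field_simp

theorem exp_neg_le_rpow {y m k q B x : ℝ} (hk : 0 < k) (hm : 0 < m) (hq : 1 ≤ q) (hx : 0 < x)
    (hB : 4 / x ≤ B) (hy : y = k / m) : exp (-(x * m / 4)) ≤ (B * y) ^ (k / q) := by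
  have hB0 : 0 < B := lt_of_lt_of_le (by positivity) hB
  have hy0 : 0 < y := by rw [hy]; positivity
  rw [rpow_def_of_pos (by positivity), exp_le_exp]
  have h1 : -log (B * y) ≤ 1 / (B * y) := by
    rw [← log_inv, ← one_div]
    exact (log_le_sub_one_of_pos (by positivity)).trans (by linarith)
  have h2 : 1 / (B * y) * (k / q) = m / (B * q) := by rw [hy]; field_simp
  have h3 : m / (B * q) ≤ x * m / 4 := by
    rw [div_le_div_iff₀ (by positivity) (by norm_num)]
    rw [div_le_iff₀ hx] at hB
    nlinarith [mul_le_mul hB hq (by norm_num) (by positivity)]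
  have h4 : -log (B * y) * (k / q) ≤ 1 / (B * y) * (k / q) := by gcongr
  linarith

theorem sqrt_pow_le_rpow {a : ℝ} {k q : ℕ} (ha : 0 < a) (ha1 : a ≤ 1) (hq : 2 ≤ q) :
    √a ^ k ≤ a ^ ((k : ℝ) / q) := by
  rw [sqrt_eq_rpow, ← rpow_natCast, ← rpow_mul ha.le]
  apply rpow_le_rpow_of_exponent_ge ha ha1
  have hq' : (2 : ℝ) ≤ q := by exact_mod_cast hq
  rw [div_le_iff₀ (by linarith)]
  nlinarith [show (0 : ℝ) ≤ k by positivity]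

theorem card_kernel_le {n m k q L : ℕ} [NeZero q] {u : ℝ} (hu₀ : 0 ≤ u) (hu₁ : u ≤ 1)
    (hL : (L : ℝ) ≤ u ^ 2 * m) (z : Fin n → Fin q)
    (hLz : L ≤ (Finset.univ.filter fun i => z i ≠ 0).card * k) :
    ((Finset.univ.filter fun c : Fin n → Fin k → Fin m => ∀ j : Fin m,
      (∑ i : Fin n, ∑ t : Fin k, if c i t = j then (z i : ℕ) else 0) % q = 0).card : ℝ) ≤
      (m : ℝ) ^ (n * k) * (2 * u) ^ L := by
  obtain ⟨T, hT, rfl⟩ := Finset.exists_subset_card_eq (s :=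
    (Finset.univ.filter fun i => z i ≠ 0) ×ˢ (Finset.univ : Finset (Fin k))) (n := L)
    (by simpa using hLz)
  have h := card_sum_single_eq_zero_le hu₀ hu₁ T
    (fun p : Fin n × Fin k => ((z p.1 : ℕ) : ZMod q)) (m := m) (fun p hp => by
      have h1 := hT hp
      simp only [Finset.mem_product, Finset.mem_filter, Finset.mem_univ, true_and,
        and_true] at h1
      rw [Ne, ZMod.natCast_eq_zero_iff]
      intro h2
      exact h1 (Fin.ext (Nat.eq_zero_of_dvd_of_lt h2 (z p.1).2))) hL
  rw [Fintype.card_prod, Fintype.card_fin, Fintype.card_fin] at h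
  refine le_trans ?_ h
  norm_cast
  apply Finset.card_le_card_of_injOn (fun c p => c p.1 p.2)
  · intro c hc
    simp only [Finset.coe_filter, Finset.mem_univ, true_and, Set.mem_ofPred_eq] at hc ⊢
    funext j
    have h3 := hc j
    rw [← Nat.dvd_iff_mod_eq_zero, ← ZMod.natCast_eq_zero_iff] at h3
    push_cast at h3
    rw [Finset.sum_apply, Fintype.sum_prod_type]
    simpa [Pi.single_apply, eq_comm] using h3
  · intro c _ c' _ hcc
    funext i t
    exact congrFun hcc (i, t)

theorem card_exists_kernel_le {n m k q E : ℕ} [NeZero q] {R : ℝ} (hR₀ : 0 ≤ R)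
    (hR : ∀ w, 1 ≤ w → w ≤ E → w ≤ n → ∃ (L : ℕ) (u : ℝ), 0 ≤ u ∧ u ≤ 1 ∧ (L : ℝ) ≤ u ^ 2 * m ∧
      L ≤ w * k ∧ (exp 1 * n * q / w) ^ w * (2 * u) ^ L ≤ n * R) :
    ((Finset.univ.filter fun c : Fin n → Fin k → Fin m => ∃ z : Fin n → Fin q, z ≠ 0 ∧
      (Finset.univ.filter fun i => z i ≠ 0).card ≤ E ∧ ∀ j : Fin m,
      (∑ i : Fin n, ∑ t : Fin k, if c i t = j then (z i : ℕ) else 0) % q = 0).card : ℝ) ≤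
      (n : ℝ) ^ 2 * R * (m : ℝ) ^ (n * k) := by
  classical
  let F : (Fin n → Fin q) → Finset (Fin n → Fin k → Fin m) := fun z =>
    Finset.univ.filter fun c => ∀ j : Fin m,
      (∑ i : Fin n, ∑ t : Fin k, if c i t = j then (z i : ℕ) else 0) % q = 0
  let Z : ℕ → Finset (Fin n → Fin q) := fun w =>
    Finset.univ.filter fun z => (Finset.univ.filter fun i => z i ≠ 0).card = w
  let G : ℕ → Finset (Fin n → Fin k → Fin m) := fun w =>
    if w ≤ E then (Z w).biUnion F else ∅
  have hsub : (Finset.univ.filter fun c : Fin n → Fin k → Fin m => ∃ z : Fin n → Fin q, z ≠ 0 ∧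
      (Finset.univ.filter fun i => z i ≠ 0).card ≤ E ∧ ∀ j : Fin m,
      (∑ i : Fin n, ∑ t : Fin k, if c i t = j then (z i : ℕ) else 0) % q = 0) ⊆
      (Finset.Icc 1 n).biUnion G := by
    intro c hc
    simp only [Finset.mem_filter, Finset.mem_univ, true_and] at hc
    obtain ⟨z, hz, hzE, hzc⟩ := hc
    obtain ⟨i, hi⟩ := Function.ne_iff.1 hz
    refine Finset.mem_biUnion.2 ⟨(Finset.univ.filter fun i => z i ≠ 0).card,
      Finset.mem_Icc.2 ⟨Finset.card_pos.2 ⟨i, by simpa using hi⟩, ?_⟩, ?_⟩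
    · simpa using Finset.card_le_univ (Finset.univ.filter fun i => z i ≠ 0)
    · simp only [G, if_pos hzE]
      exact Finset.mem_biUnion.2 ⟨z, by simp [Z], by simpa [F] using hzc⟩
  have hG : ∀ w ∈ Finset.Icc 1 n, ((G w).card : ℝ) ≤ n * R * (m : ℝ) ^ (n * k) := by
    intro w hw
    rw [Finset.mem_Icc] at hw
    by_cases hwE : w ≤ E
    · obtain ⟨L, u, hu₀, hu₁, hL, hLw, h⟩ := hR w hw.1 hwE hw.2
      simp only [G, if_pos hwE]
      have hF : ∀ z ∈ Z w, ((F z).card : ℝ) ≤ (m : ℝ) ^ (n * k) * (2 * u) ^ L := by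
        intro z hz
        simp only [Z, Finset.mem_filter, Finset.mem_univ, true_and] at hz
        exact card_kernel_le hu₀ hu₁ hL z (by rw [hz]; exact hLw)
      calc (((Z w).biUnion F).card : ℝ) ≤ ∑ z ∈ Z w, ((F z).card : ℝ) := by
            exact_mod_cast Finset.card_biUnion_le
        _ ≤ ∑ z ∈ Z w, (m : ℝ) ^ (n * k) * (2 * u) ^ L := Finset.sum_le_sum hF
        _ = (Z w).card * ((m : ℝ) ^ (n * k) * (2 * u) ^ L) := by simp
        _ ≤ (exp 1 * n * q / w) ^ w * ((m : ℝ) ^ (n * k) * (2 * u) ^ L) := by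
            gcongr
            exact card_weight_eq_le
        _ = (exp 1 * n * q / w) ^ w * (2 * u) ^ L * (m : ℝ) ^ (n * k) := by ring
        _ ≤ _ := by gcongr
    · simp only [G, if_neg hwE, Finset.card_empty, Nat.cast_zero]
      positivity
  calc _ ≤ (((Finset.Icc 1 n).biUnion G).card : ℝ) := by exact_mod_cast Finset.card_le_card hsub
    _ ≤ ∑ w ∈ Finset.Icc 1 n, ((G w).card : ℝ) := by exact_mod_cast Finset.card_biUnion_le
    _ ≤ ∑ w ∈ Finset.Icc 1 n, n * R * (m : ℝ) ^ (n * k) := Finset.sum_le_sum hG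
    _ = _ := by simp; ring

/-- No small-weight kernel vectors: for the random `m×n` matrix `H` over `Z_q` with iid
weight-`k` columns (encoded by the uniform choice function `c : Fin n → Fin k → Fin m`),
with `q` prime, `q ∤ k`, `3 ≤ k ≤ m/log m`, `m ≤ n` and `(m/(nk))^{1/k} ≥ Δ > 0`, there
are constants `B, C` depending only on `q` and `Δ` such that whenever
`E ≤ C·m/log(nk/m)`, the probability that some nonzero `z ∈ {0,…,q−1}^n` with at most `E`
nonzero entries satisfies `Hz ≡ 0 mod q` is at most `n²·(Bk/m)^{k/q}`. -/
theorem no_small_weight_kernel_vectors (q : ℕ) (hq : q.Prime) (Δ : ℝ) (hΔ : 0 < Δ) :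
    ∃ B C : ℝ, 0 < B ∧ 0 < C ∧ ∀ n m k E : ℕ,
      ¬ q ∣ k → 3 ≤ k → (k : ℝ) ≤ (m : ℝ) / Real.log m → m ≤ n →
      Δ ≤ ((m : ℝ) / ((n : ℝ) * k)) ^ (1 / (k : ℝ)) →
      (E : ℝ) ≤ C * m / Real.log ((n : ℝ) * k / m) →
      (Nat.card {c : Fin n → Fin k → Fin m //
          ∃ z : Fin n → Fin q, z ≠ (fun _ => ⟨0, hq.pos⟩) ∧
            Nat.card {i : Fin n // (z i : ℕ) ≠ 0} ≤ E ∧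
            ∀ j : Fin m, (∑ i : Fin n, ∑ t : Fin k,
              if c i t = j then (z i : ℕ) else 0) % q = 0} : ℝ) / (m : ℝ) ^ (n * k)
        ≤ (n : ℝ) ^ 2 * (B * k / m) ^ ((k : ℝ) / q) := by
  have hq2 := hq.two_le
  have hq' : (2 : ℝ) ≤ q := by exact_mod_cast hq2
  have : NeZero q := ⟨hq.pos.ne'⟩
  obtain ⟨A, hA⟩ : ∃ A : ℝ, A = 6 * q * (1 + 1 / Δ) := ⟨_, rfl⟩
  have hA12 : 12 ≤ A := by
    have : 0 < 1 / Δ := by positivity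
    rw [hA]; nlinarith
  have hA6 : 12 ^ 6 ≤ A ^ 6 := by gcongr
  obtain ⟨x, hx⟩ : ∃ x : ℝ, x = 1 / (2 * A ^ 6) := ⟨_, rfl⟩
  have hx0 : 0 < x := by rw [hx]; positivity
  have hxA : x * A ^ 6 = 1 / 2 := by rw [hx]; field_simp
  have hx1 : x ≤ 1 / 1000 := by nlinarith
  have hBx : 4 / x = 8 * A ^ 6 := by rw [hx]; field_simp; norm_num
  have hK : 0 ≤ log (exp 1 * q / x) := by
    apply log_nonneg
    rw [le_div_iff₀ hx0]
    nlinarith [add_one_le_exp (1 : ℝ)]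
  refine ⟨8 * A ^ 6, x / 4 / (1 + log (exp 1 * q / x)), by positivity, by positivity, ?_⟩
  intro n m k E _ hk hkm hmn hΔk hE
  have hk' : (3 : ℝ) ≤ k := by exact_mod_cast hk
  have hm : 1 ≤ m := by
    rcases Nat.eq_zero_or_pos m with rfl | h
    · simp at hkm; omega
    · exact h
  have hm' : (1 : ℝ) ≤ m := by exact_mod_cast hm
  have hn' : (m : ℝ) ≤ n := by exact_mod_cast hmn
  rw [div_le_iff₀ (by positivity), Nat.card_eq_fintype_card, Fintype.card_subtype]
  have hbase : 8 * A ^ 6 * k / m = 8 * A ^ 6 * (k / m) := by ring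
  by_cases hB : 8 * A ^ 6 * k / m ≤ 1
  swap
  · have h1 : (1 : ℝ) ≤ (8 * A ^ 6 * k / m) ^ ((k : ℝ) / q) :=
      one_le_rpow (not_le.1 hB).le (by positivity)
    have h2 : (1 : ℝ) ≤ (n : ℝ) ^ 2 := one_le_pow₀ (hm'.trans hn')
    refine le_trans ?_ (le_mul_of_one_le_left (by positivity)
      (one_le_mul_of_one_le_of_one_le h2 h1))
    have h3 := Finset.card_filter_le (Finset.univ : Finset (Fin n → Fin k → Fin m)) fun c =>
      ∃ z : Fin n → Fin q, z ≠ (fun _ => ⟨0, hq.pos⟩) ∧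
        Nat.card {i : Fin n // (z i : ℕ) ≠ 0} ≤ E ∧
        ∀ j : Fin m, (∑ i : Fin n, ∑ t : Fin k, if c i t = j then (z i : ℕ) else 0) % q = 0
    rw [Finset.card_univ, Fintype.card_fun, Fintype.card_fun, Fintype.card_fin,
      Fintype.card_fin, Fintype.card_fin, ← pow_mul, mul_comm k n] at h3
    exact_mod_cast h3
  rw [hbase] at hB ⊢
  have hy : (0 : ℝ) < k / m := by positivity
  have hny₁ : 1 ≤ (n : ℝ) * (k / m) := by
    rw [← mul_div_assoc, one_le_div (by positivity)]
    nlinarith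
  have hny : (n : ℝ) * (k / m) ≤ (1 / Δ) ^ k := by
    have h1 : Δ ^ k ≤ m / (n * k) := by
      have hk0 : (k : ℝ) ≠ 0 := by positivity
      calc Δ ^ k ≤ (((m : ℝ) / (n * k)) ^ (1 / (k : ℝ))) ^ k := by gcongr
        _ = _ := by
          rw [← rpow_natCast, ← rpow_mul (by positivity), one_div_mul_cancel hk0, rpow_one]
    rw [one_div_pow, le_one_div (by positivity) (by positivity)]
    exact h1.trans_eq (by field_simp)
  have hxm : 2 ≤ x * m := by
    rw [← mul_div_assoc, div_le_one (by positivity)] at hB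
    rw [hx, one_div_mul_eq_div, le_div_iff₀ (by positivity)]
    nlinarith
  have main := card_exists_kernel_le (n := n) (m := m) (k := k) (q := q) (E := E)
    (R := (8 * A ^ 6 * (k / m)) ^ ((k : ℝ) / q)) (by positivity) (by
      intro w hw hwE hwn
      by_cases hs : (w * k : ℝ) ≤ x * m
      · have hwy : (w : ℝ) * (k / m) ≤ x := by
          rw [← mul_div_assoc, div_le_iff₀ (by positivity)]; exact hs
        refine ⟨w * k, √(w * (k / m)), sqrt_nonneg _, ?_, ?_, le_rfl, ?_⟩
        · rw [sqrt_le_one]; linarith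
        · rw [sq_sqrt (by positivity)]
          apply le_of_eq
          push_cast
          field_simp
        · refine (sparse_term_le hΔ hq2 hk hw hy hny₁ hny hA ?_
            (by linarith : A ^ 6 ≤ 8 * A ^ 6)).trans ?_
          · rw [← hxA, mul_comm x]; gcongr
          · gcongr
            exact sqrt_pow_le_rpow (by positivity) hB hq2
      · have hs' := (not_le.1 hs).le
        have hfl : (⌊x * m⌋₊ : ℝ) ≤ x * m := Nat.floor_le (by positivity)
        have hfl' : x * m - 1 < ⌊x * m⌋₊ := Nat.sub_one_lt_floor _
        have he1 : (1 : ℝ) / 3 ≤ exp (-1) := by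
          rw [exp_neg, one_div]
          exact inv_anti₀ (exp_pos _) exp_one_lt_three.le
        refine ⟨⌊x * m⌋₊, exp (-1) / 2, by positivity, ?_, ?_, ?_, ?_⟩
        · have : exp (-1) ≤ 1 := exp_le_one_iff.2 (by norm_num)
          linarith
        · refine hfl.trans ?_
          gcongr
          nlinarith
        · exact_mod_cast hfl.trans hs'
        · have h1 := entropy_term_le hq2 hk hm hw hmn hx0 (by linarith) hs' rfl
            (le_trans (by exact_mod_cast hwE) hE)
          have h2 : (2 * (exp (-1) / 2)) ^ ⌊x * m⌋₊ ≤ exp (-(x * m / 2)) := by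
            rw [mul_div_cancel₀ _ two_ne_zero, ← exp_nat_mul, exp_le_exp]
            linarith
          have h3 := exp_neg_le_rpow (by linarith : (0 : ℝ) < k) (by linarith : (0 : ℝ) < m)
            (by linarith : (1 : ℝ) ≤ q) hx0 hBx.le rfl
          calc _ ≤ exp (x * m / 4) * exp (-(x * m / 2)) := by gcongr
            _ = exp (-(x * m / 4)) := by rw [← exp_add]; congr 1; ring
            _ ≤ _ := h3
            _ ≤ _ := le_mul_of_one_le_left (by positivity) (hm'.trans hn'))
  refine le_trans (le_of_eq ?_) main
  congr 2
  ext c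
  simp only [Finset.mem_filter, Finset.mem_univ, true_and]
  refine exists_congr fun z => and_congr Iff.rfl (and_congr ?_ Iff.rfl)
  rw [Nat.card_eq_fintype_card, Fintype.card_subtype]
  simp only [Ne, Fin.val_eq_zero_iff]
end
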